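/- arXiv:2304.07383 — 16 statements merged into one kernel-verified Lean document; each statement's English description precedes it below -/
import Mathlib

section
/- Let m > 0 and ℓ > 0, and consider the horizon equation r·e^{ℓ/r} = 2m for r > 0 (equivalently f(r) = 0). If 0 < ℓ < 2m/e then the equation has exactly two solutions r₋ and r₊, and they satisfy 0 < r₋ < ℓ < r₊; if ℓ = 2m/e it has exactly one solution, namely r = ℓ; and if ℓ > 2m/e it has no solutions. -/
/-- `r * exp (ℓ / r)` strictly increases when `r > 0` moves away from `ℓ`: from `a` to any
`b ≠ a` lying on the side of `a` opposite to `ℓ`. -/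
theorem mul_exp_div_lt_mul_exp_div {ℓ a b : ℝ} (ha : 0 < a) (hb : 0 < b) (hab : a ≠ b)
    (h : (a - b) * (a - ℓ) ≤ 0) : a * Real.exp (ℓ / a) < b * Real.exp (ℓ / b) := by
  have hne : a / b - 1 ≠ 0 := by
    rw [sub_ne_zero, Ne, div_eq_one_iff_eq hb.ne']
    exact hab
  have hle : a / b - 1 ≤ ℓ / b - ℓ / a := by
    have key : a / b - 1 - (ℓ / b - ℓ / a) = (a - b) * (a - ℓ) / (a * b) := by
      field_simp
    have : (a - b) * (a - ℓ) / (a * b) ≤ 0 := div_nonpos_of_nonpos_of_nonneg h (by positivity)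
    linarith
  have hlt : a / b < Real.exp (ℓ / b - ℓ / a) := by
    linarith [Real.add_one_lt_exp hne, Real.exp_le_exp.mpr hle]
  rwa [Real.exp_sub, div_lt_div_iff₀ hb (Real.exp_pos _), mul_comm (Real.exp _)] at hlt

theorem strictMonoOn_mul_exp_div {ℓ : ℝ} (hℓ : 0 < ℓ) :
    StrictMonoOn (fun r : ℝ => r * Real.exp (ℓ / r)) (Set.Ici ℓ) := by
  intro a ha b _ hab
  have ha' : ℓ ≤ a := ha
  have ha0 := hℓ.trans_le ha'
  exact mul_exp_div_lt_mul_exp_div ha0 (ha0.trans hab) hab.ne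
    (mul_nonpos_of_nonpos_of_nonneg (by linarith) (by linarith))

theorem strictAntiOn_mul_exp_div (ℓ : ℝ) :
    StrictAntiOn (fun r : ℝ => r * Real.exp (ℓ / r)) (Set.Ioc 0 ℓ) := by
  intro a ha b hb hab
  exact mul_exp_div_lt_mul_exp_div hb.1 ha.1 hab.ne'
    (mul_nonpos_of_nonneg_of_nonpos (by linarith) (by linarith [hb.2]))

theorem mul_exp_one_lt_mul_exp_div {ℓ r : ℝ} (hℓ : 0 < ℓ) (hr : 0 < r) (h : r ≠ ℓ) :
    ℓ * Real.exp 1 < r * Real.exp (ℓ / r) := by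
  simpa [div_self hℓ.ne'] using mul_exp_div_lt_mul_exp_div (ℓ := ℓ) hℓ hr h.symm (by simp)

theorem continuousOn_mul_exp_div (ℓ : ℝ) :
    ContinuousOn (fun r : ℝ => r * Real.exp (ℓ / r)) (Set.Ioi 0) :=
  continuousOn_id.mul (Real.continuous_exp.comp_continuousOn
    (continuousOn_const.div continuousOn_id fun _ hr => (Set.mem_Ioi.mp hr).ne'))

theorem exists_mul_exp_div_eq_of_lt {ℓ c : ℝ} (hℓ : 0 < ℓ) (hc : ℓ * Real.exp 1 < c) :
    ∃ r, 0 < r ∧ r < ℓ ∧ r * Real.exp (ℓ / r) = c := by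
  have hℓc : ℓ < c := by nlinarith [Real.add_one_le_exp (1 : ℝ)]
  have hc0 := hℓ.trans hℓc
  have ha0 : 0 < ℓ ^ 2 / (2 * c) := by positivity
  have haℓ : ℓ ^ 2 / (2 * c) < ℓ := by
    rw [div_lt_iff₀ (by positivity)]
    nlinarith
  have hac : c < ℓ ^ 2 / (2 * c) * Real.exp (ℓ / (ℓ ^ 2 / (2 * c))) := by
    have hx : ℓ / (ℓ ^ 2 / (2 * c)) = 2 * c / ℓ := by field_simp
    rw [hx]
    have hx0 : 0 < 2 * c / ℓ := by positivity
    have hexp : (2 * c / ℓ) ^ 2 / 2 < Real.exp (2 * c / ℓ) := by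
      linarith [Real.quadratic_le_exp_of_nonneg hx0.le]
    calc c = ℓ ^ 2 / (2 * c) * ((2 * c / ℓ) ^ 2 / 2) := by field_simp
      _ < _ := mul_lt_mul_of_pos_left hexp ha0
  obtain ⟨r, hr, hrc⟩ := intermediate_value_Ioo' haℓ.le
    ((continuousOn_mul_exp_div ℓ).mono fun x hx => ha0.trans_le hx.1)
    ⟨by simpa [div_self hℓ.ne'] using hc, hac⟩
  exact ⟨r, ha0.trans hr.1, hr.2, hrc⟩

theorem exists_mul_exp_div_eq_of_gt {ℓ c : ℝ} (hℓ : 0 < ℓ) (hc : ℓ * Real.exp 1 < c) :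
    ∃ r, ℓ < r ∧ r * Real.exp (ℓ / r) = c := by
  have hℓc : ℓ < c := by nlinarith [Real.add_one_le_exp (1 : ℝ)]
  have hc0 := hℓ.trans hℓc
  have hcc : c < c * Real.exp (ℓ / c) :=
    lt_mul_of_one_lt_right hc0 (Real.one_lt_exp_iff.mpr (by positivity))
  obtain ⟨r, hr, hrc⟩ := intermediate_value_Ioo hℓc.le
    ((continuousOn_mul_exp_div ℓ).mono fun x hx => hℓ.trans_le hx.1)
    ⟨by simpa [div_self hℓ.ne'] using hc, hcc⟩
  exact ⟨r, hr.1, hrc⟩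

/-- aMc spacetime horizon structure: for `0 < ℓ < 2m/e` the horizon equation
`r·e^{ℓ/r} = 2m` has exactly two positive solutions, with `0 < r₋ < ℓ < r₊`;
for `ℓ = 2m/e` exactly one, namely `r = ℓ`; for `ℓ > 2m/e` none. -/
theorem aMc_horizon_structure (m ℓ : ℝ) (hm : 0 < m) (hℓ : 0 < ℓ) :
    (ℓ < 2 * m / Real.exp 1 →
      ∃ rm rp : ℝ, 0 < rm ∧ rm < ℓ ∧ ℓ < rp ∧
        ∀ r : ℝ, 0 < r → (r * Real.exp (ℓ / r) = 2 * m ↔ r = rm ∨ r = rp)) ∧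
    (ℓ = 2 * m / Real.exp 1 →
      ∀ r : ℝ, 0 < r → (r * Real.exp (ℓ / r) = 2 * m ↔ r = ℓ)) ∧
    (ℓ > 2 * m / Real.exp 1 →
      ∀ r : ℝ, 0 < r → r * Real.exp (ℓ / r) ≠ 2 * m) := by
  refine ⟨fun h => ?_, fun h r hr => ?_, fun h r hr => ?_⟩
  · rw [lt_div_iff₀ (Real.exp_pos 1)] at h
    obtain ⟨rm, hm0, hmℓ, hmeq⟩ := exists_mul_exp_div_eq_of_lt hℓ h
    obtain ⟨rp, hpℓ, hpeq⟩ := exists_mul_exp_div_eq_of_gt hℓ h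
    refine ⟨rm, rp, hm0, hmℓ, hpℓ, fun r hr => ⟨fun hreq => ?_, ?_⟩⟩
    · rcases le_total r ℓ with hrℓ | hrℓ
      · exact .inl ((strictAntiOn_mul_exp_div ℓ).injOn ⟨hr, hrℓ⟩ ⟨hm0, hmℓ.le⟩
          (hreq.trans hmeq.symm))
      · exact .inr ((strictMonoOn_mul_exp_div hℓ).injOn hrℓ hpℓ.le (hreq.trans hpeq.symm))
    · rintro (rfl | rfl)
      exacts [hmeq, hpeq]
  · rw [eq_div_iff (Real.exp_pos 1).ne'] at h
    constructor
    · intro hreq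
      by_contra hne
      exact (mul_exp_one_lt_mul_exp_div hℓ hr hne).ne (h.trans hreq.symm)
    · rintro rfl
      rwa [div_self hr.ne']
  · rw [gt_iff_lt, div_lt_iff₀ (Real.exp_pos 1)] at h
    rcases eq_or_ne r ℓ with rfl | hne
    · rw [div_self hr.ne']
      exact h.ne'
    · exact (h.trans (mul_exp_one_lt_mul_exp_div hℓ hr hne)).ne'
end

section
/- Fix m > 0 and let r : (0, 2m/e) → ℝ be any function such that for every ℓ ∈ (0, 2m/e) one has r(ℓ)·e^{ℓ/r(ℓ)} = 2m and r(ℓ) > ℓ (i.e. r(ℓ) is the outer horizon radius). Then (r(ℓ) − 2m)/ℓ → −1 as ℓ → 0⁺; in particular r(ℓ) → 2m as ℓ → 0⁺ (the perturbative expansion r_{H+} = 2m − ℓ + O(ℓ²)). -/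
/-- Two-sided bound on the difference quotient of the outer root of `R * exp (ℓ / R) = a`. -/
theorem outer_root_quotient_bounds {a ℓ R : ℝ} (ha : 0 < a) (hℓ : 0 < ℓ)
    (hR : R * Real.exp (ℓ / R) = a) (hlt : ℓ < R) :
    -Real.exp (ℓ * Real.exp 1 / a) ≤ (R - a) / ℓ ∧ (R - a) / ℓ ≤ -1 := by
  have hRpos : 0 < R := hℓ.trans hlt
  have hmul : R * (ℓ / R) = ℓ := mul_div_cancel₀ ℓ hRpos.ne'
  have hsmall : ℓ / R ≤ ℓ * Real.exp 1 / a := by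
    have hexp : Real.exp (ℓ / R) ≤ Real.exp 1 :=
      Real.exp_le_exp.mpr ((div_le_one hRpos).mpr hlt.le)
    have haR : a ≤ R * Real.exp 1 := hR ▸ mul_le_mul_of_nonneg_left hexp hRpos.le
    rw [div_le_div_iff₀ hRpos ha]
    nlinarith
  constructor
  · have hneg : 1 - ℓ / R ≤ Real.exp (-(ℓ / R)) := by
      linarith [Real.add_one_le_exp (-(ℓ / R))]
    have hinv : Real.exp (ℓ / R) * Real.exp (-(ℓ / R)) = 1 := by
      rw [← Real.exp_add, add_neg_cancel, Real.exp_zero]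
    have hle : Real.exp (ℓ / R) * (1 - ℓ / R) ≤ 1 :=
      (mul_le_mul_of_nonneg_left hneg (Real.exp_pos _).le).trans_eq hinv
    have hlower : -Real.exp (ℓ / R) ≤ (R - a) / ℓ := by
      rw [le_div_iff₀ hℓ]
      have hscaled := mul_le_mul_of_nonneg_left hle hRpos.le
      have hexpand : R * (Real.exp (ℓ / R) * (1 - ℓ / R)) = a - Real.exp (ℓ / R) * ℓ := by
        linear_combination hR - Real.exp (ℓ / R) * hmul
      linarith
    exact (neg_le_neg (Real.exp_le_exp.mpr hsmall)).trans hlower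
  · rw [div_le_iff₀ hℓ]
    have hscaled := mul_le_mul_of_nonneg_left (Real.add_one_le_exp (ℓ / R)) hRpos.le
    linarith


/-- Perturbative expansion of the outer horizon of the aMc spacetime:
if `r ℓ` satisfies `r ℓ · e^{ℓ / r ℓ} = 2m` with `r ℓ > ℓ` for each
`ℓ ∈ (0, 2m/e)`, then `(r ℓ − 2m)/ℓ → −1` as `ℓ → 0⁺`; in particular
`r ℓ → 2m` as `ℓ → 0⁺`. -/
theorem aMc_outer_horizon_small_ell (m : ℝ) (hm : 0 < m) (r : ℝ → ℝ)
    (hr : ∀ ℓ : ℝ, 0 < ℓ → ℓ < 2 * m / Real.exp 1 →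
      r ℓ * Real.exp (ℓ / r ℓ) = 2 * m ∧ ℓ < r ℓ) :
    Filter.Tendsto (fun ℓ : ℝ => (r ℓ - 2 * m) / ℓ)
        (nhdsWithin 0 (Set.Ioi 0)) (nhds (-1)) ∧
    Filter.Tendsto r (nhdsWithin 0 (Set.Ioi 0)) (nhds (2 * m)) := by
  have hbounds : ∀ᶠ ℓ in nhdsWithin (0 : ℝ) (Set.Ioi 0),
      -Real.exp (ℓ * Real.exp 1 / (2 * m)) ≤ (r ℓ - 2 * m) / ℓ ∧ (r ℓ - 2 * m) / ℓ ≤ -1 := by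
    have hpos : 0 < 2 * m / Real.exp 1 := by positivity
    filter_upwards [Ioo_mem_nhdsGT hpos] with ℓ hℓ
    obtain ⟨hroot, hlt⟩ := hr ℓ hℓ.1 hℓ.2
    exact outer_root_quotient_bounds (by positivity) hℓ.1 hroot hlt
  have hlower : Filter.Tendsto (fun ℓ : ℝ => -Real.exp (ℓ * Real.exp 1 / (2 * m)))
      (nhdsWithin 0 (Set.Ioi 0)) (nhds (-1)) := by
    have hcont : Continuous fun ℓ : ℝ => -Real.exp (ℓ * Real.exp 1 / (2 * m)) := by fun_prop
    simpa using (hcont.tendsto 0).mono_left nhdsWithin_le_nhds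
  have hquot : Filter.Tendsto (fun ℓ : ℝ => (r ℓ - 2 * m) / ℓ)
      (nhdsWithin 0 (Set.Ioi 0)) (nhds (-1)) :=
    tendsto_of_tendsto_of_tendsto_of_le_of_le' hlower tendsto_const_nhds
      (hbounds.mono fun _ h => h.1) (hbounds.mono fun _ h => h.2)
  refine ⟨hquot, ?_⟩
  have hid : Filter.Tendsto (fun ℓ : ℝ => ℓ) (nhdsWithin 0 (Set.Ioi 0)) (nhds 0) :=
    nhdsWithin_le_nhds
  have hlim : Filter.Tendsto (fun ℓ : ℝ => 2 * m + ℓ * ((r ℓ - 2 * m) / ℓ))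
      (nhdsWithin 0 (Set.Ioi 0)) (nhds (2 * m)) := by
    simpa using (hid.mul hquot).const_add (2 * m)
  refine hlim.congr' ?_
  filter_upwards [self_mem_nhdsWithin] with ℓ hℓ
  rw [mul_div_cancel₀ _ (ne_of_gt hℓ), add_sub_cancel]
end

section
/- Fix m > 0 and let r : (0, 2m/e) → ℝ be any function such that for every ℓ ∈ (0, 2m/e) one has r(ℓ)·e^{ℓ/r(ℓ)} = 2m and 0 < r(ℓ) < ℓ (i.e. r(ℓ) is the inner horizon radius). Then r(ℓ)·log(2m/ℓ)/ℓ → 1 as ℓ → 0⁺; that is, asymptotically r_{H−}/ℓ ∼ 1/log(2m/ℓ) as ℓ/m → 0. -/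
/-- If `x · e^{ℓ / x} = c`, then `u = ℓ / x` satisfies `log (c / ℓ) = u - log u`. -/
lemma log_div_eq_sub_log_of_mul_exp_eq {x ℓ c : ℝ} (hx : 0 < x) (hℓ : 0 < ℓ)
    (h : x * Real.exp (ℓ / x) = c) :
    Real.log (c / ℓ) = ℓ / x - Real.log (ℓ / x) := by
  have hc : c / ℓ = Real.exp (ℓ / x) / (ℓ / x) := by
    rw [← h]
    field_simp
  rw [hc, Real.log_div (Real.exp_ne_zero _) (div_pos hℓ hx).ne', Real.log_exp]

/-- Asymptotics of the inner horizon of the aMc spacetime: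
if `r ℓ` satisfies `r ℓ · e^{ℓ / r ℓ} = 2m` with `0 < r ℓ < ℓ` for each
`ℓ ∈ (0, 2m/e)`, then `r ℓ · log(2m/ℓ)/ℓ → 1` as `ℓ → 0⁺`. -/
theorem aMc_inner_horizon_asymptotics (m : ℝ) (hm : 0 < m) (r : ℝ → ℝ)
    (hr : ∀ ℓ : ℝ, 0 < ℓ → ℓ < 2 * m / Real.exp 1 →
      r ℓ * Real.exp (ℓ / r ℓ) = 2 * m ∧ 0 < r ℓ ∧ r ℓ < ℓ) :
    Filter.Tendsto (fun ℓ : ℝ => r ℓ * Real.log (2 * m / ℓ) / ℓ)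
      (nhdsWithin 0 (Set.Ioi 0)) (nhds 1) := by
  have hsmall : ∀ᶠ ℓ : ℝ in nhdsWithin 0 (Set.Ioi 0), ℓ ∈ Set.Ioo 0 (2 * m / Real.exp 1) :=
    Ioo_mem_nhdsGT (by positivity)
  have hlog : Filter.Tendsto (fun ℓ : ℝ => Real.log (2 * m / ℓ))
      (nhdsWithin 0 (Set.Ioi 0)) Filter.atTop := by
    simp only [div_eq_mul_inv]
    exact Real.tendsto_log_atTop.comp
      (tendsto_inv_nhdsGT_zero.const_mul_atTop (by positivity : 0 < 2 * m))
  have hu : Filter.Tendsto (fun ℓ : ℝ => ℓ / r ℓ) (nhdsWithin 0 (Set.Ioi 0)) Filter.atTop := by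
    refine Filter.tendsto_atTop_mono' _ ?_ hlog
    filter_upwards [hsmall] with ℓ hℓ
    obtain ⟨h, hpos, hlt⟩ := hr ℓ hℓ.1 hℓ.2
    rw [log_div_eq_sub_log_of_mul_exp_eq hpos hℓ.1 h]
    linarith [Real.log_nonneg ((one_le_div hpos).2 hlt.le)]
  have hlim := (Real.isLittleO_log_id_atTop.tendsto_div_nhds_zero.comp hu).const_sub 1
  rw [sub_zero] at hlim
  refine hlim.congr' ?_
  filter_upwards [hsmall] with ℓ hℓ
  obtain ⟨h, hpos, -⟩ := hr ℓ hℓ.1 hℓ.2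
  have hℓ0 := hℓ.1.ne'
  rw [log_div_eq_sub_log_of_mul_exp_eq hpos hℓ.1 h]
  simp only [Function.comp_apply, id_eq]
  field_simp
end

section
/- For every real w > 1/3 one has w²·e^{1/w}/(3w − 1) ≥ e^{(5−√13)/2}·(2 + √13)/9, with equality if and only if w = (5 + √13)/6. -/
/-- The tangent line of `x (3 - x)` at `x₀ = (5 - √13) / 2` is `(√13 - 2) (1 + (x - x₀))`, which the
exponential bounds from above. -/
lemma mul_three_sub_lt_exp {x : ℝ} (hx : x ≠ (5 - Real.sqrt 13) / 2) :
    x * (3 - x) < (Real.sqrt 13 - 2) * Real.exp (x - (5 - Real.sqrt 13) / 2) := by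
  have hs : Real.sqrt 13 ^ 2 = 13 := Real.sq_sqrt (by norm_num)
  have hc : 0 < Real.sqrt 13 - 2 := sub_pos.2 (Real.lt_sqrt_of_sq_lt (by norm_num))
  have ht : 0 < (x - (5 - Real.sqrt 13) / 2) ^ 2 := sq_pos_of_ne_zero (sub_ne_zero.2 hx)
  have h := mul_le_mul_of_nonneg_left
    (Real.add_one_le_exp (x - (5 - Real.sqrt 13) / 2)) hc.le
  nlinarith

lemma exp_mul_lt_photon_orbit_function {w : ℝ} (hw : 1 / 3 < w)
    (hne : w ≠ (5 + Real.sqrt 13) / 6) :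
    Real.exp ((5 - Real.sqrt 13) / 2) * (2 + Real.sqrt 13) / 9 <
      w ^ 2 * Real.exp (1 / w) / (3 * w - 1) := by
  have hs : Real.sqrt 13 ^ 2 = 13 := Real.sq_sqrt (by norm_num)
  have hs0 : 0 ≤ Real.sqrt 13 := Real.sqrt_nonneg 13
  have hw0 : 0 < w := by linarith
  have hx : 1 / w ≠ (5 - Real.sqrt 13) / 2 := by
    intro h
    rw [div_eq_iff hw0.ne'] at h
    apply hne
    linear_combination (-(5 + Real.sqrt 13) / 6) * h + w / 12 * hs
  have h := mul_three_sub_lt_exp hx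
  have hq : 1 / w * (3 - 1 / w) = (3 * w - 1) / w ^ 2 := by field_simp
  rw [hq, Real.exp_sub, div_lt_iff₀ (by positivity)] at h
  rw [lt_div_iff₀ (by linarith)]
  have h' := mul_lt_mul_of_pos_left h
    (show 0 < Real.exp ((5 - Real.sqrt 13) / 2) * (2 + Real.sqrt 13) / 9 by positivity)
  refine h'.trans_eq ?_
  field_simp
  linear_combination hs

lemma photon_orbit_function_at_min :
    ((5 + Real.sqrt 13) / 6) ^ 2 * Real.exp (1 / ((5 + Real.sqrt 13) / 6)) /
        (3 * ((5 + Real.sqrt 13) / 6) - 1) =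
      Real.exp ((5 - Real.sqrt 13) / 2) * (2 + Real.sqrt 13) / 9 := by
  have hs : Real.sqrt 13 ^ 2 = 13 := Real.sq_sqrt (by norm_num)
  have hs0 : 0 ≤ Real.sqrt 13 := Real.sqrt_nonneg 13
  have hx : 1 / ((5 + Real.sqrt 13) / 6) = (5 - Real.sqrt 13) / 2 := by
    rw [div_eq_iff (by positivity)]
    linear_combination hs / 12
  rw [hx, div_eq_iff (by linarith)]
  linear_combination (-Real.exp ((5 - Real.sqrt 13) / 2) / 36) * hs

/-- For `w > 1/3` the photon-orbit function `w²·e^{1/w}/(3w − 1)` is bounded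
below by `e^{(5−√13)/2}·(2 + √13)/9`, with equality exactly at
`w = (5 + √13)/6`. -/
theorem photon_orbit_function_min (w : ℝ) (hw : 1 / 3 < w) :
    Real.exp ((5 - Real.sqrt 13) / 2) * (2 + Real.sqrt 13) / 9 ≤
      w ^ 2 * Real.exp (1 / w) / (3 * w - 1) ∧
    (w ^ 2 * Real.exp (1 / w) / (3 * w - 1) =
        Real.exp ((5 - Real.sqrt 13) / 2) * (2 + Real.sqrt 13) / 9 ↔
      w = (5 + Real.sqrt 13) / 6) := by
  by_cases h : w = (5 + Real.sqrt 13) / 6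
  · subst h
    exact ⟨photon_orbit_function_at_min.ge, iff_of_true photon_orbit_function_at_min rfl⟩
  · have hlt := exp_mul_lt_photon_orbit_function hw h
    exact ⟨hlt.le, iff_of_false hlt.ne' h⟩
end

section
/- Let m > 0 and ℓ > 0 with m/ℓ < e^{(5−√13)/2}·(2 + √13)/9 (equivalently ℓ/m > e^{−(5−√13)/2}·(√13 − 2)). Then there is no r > 0 satisfying r² = m·e^{−ℓ/r}·(3r − ℓ); that is, the aMc spacetime possesses no circular photon orbits. -/
/-- The function `x ↦ x (3 - x) e^{-x}` attains its global maximum at `(5 - √13) / 2`. -/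
theorem mul_three_sub_le_exp (x : ℝ) :
    x * (3 - x) ≤ (Real.sqrt 13 - 2) * Real.exp (x - (5 - Real.sqrt 13) / 2) := by
  have hs : Real.sqrt 13 ^ 2 = 13 := Real.sq_sqrt (by norm_num)
  have hs2 : 2 ≤ Real.sqrt 13 := Real.le_sqrt_of_sq_le (by norm_num)
  have hexp := mul_le_mul_of_nonneg_left
    (Real.add_one_le_exp (x - (5 - Real.sqrt 13) / 2)) (sub_nonneg.2 hs2)
  nlinarith [sq_nonneg (x - (5 - Real.sqrt 13) / 2)]

/-- Nonexistence of photon spheres in the aMc spacetime: if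
`m/ℓ < e^{(5−√13)/2}·(2 + √13)/9` then no `r > 0` satisfies
`r² = m·e^{−ℓ/r}·(3r − ℓ)`. -/
theorem aMc_no_photon_sphere (m ℓ : ℝ) (hm : 0 < m) (hℓ : 0 < ℓ)
    (h : m / ℓ < Real.exp ((5 - Real.sqrt 13) / 2) * (2 + Real.sqrt 13) / 9) :
    ¬ ∃ r : ℝ, 0 < r ∧ r ^ 2 = m * Real.exp (-ℓ / r) * (3 * r - ℓ) := by
  rintro ⟨r, hr, heq⟩
  have hs : Real.sqrt 13 ^ 2 = 13 := Real.sq_sqrt (by norm_num)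
  have hs2 : 2 < Real.sqrt 13 := Real.lt_sqrt_of_sq_lt (by norm_num)
  have hmax := mul_three_sub_le_exp (ℓ / r)
  rw [div_lt_iff₀ hℓ] at h
  set a := (5 - Real.sqrt 13) / 2
  have hlt : m * (Real.sqrt 13 - 2) < ℓ * Real.exp a := by
    have h1 := mul_lt_mul_of_pos_right h (sub_pos.2 hs2)
    have h2 : Real.exp a * (2 + Real.sqrt 13) / 9 * ℓ * (Real.sqrt 13 - 2)
        = ℓ * Real.exp a := by
      linear_combination Real.exp a * ℓ / 9 * hs
    rwa [h2] at h1
  have hℓ_eq : ℓ = m * Real.exp (-ℓ / r) * (ℓ / r * (3 - ℓ / r)) := by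
    field_simp
    rw [← neg_div]
    linear_combination heq
  have hexp : Real.exp (-ℓ / r) * Real.exp (ℓ / r - a) * Real.exp a = 1 := by
    rw [← Real.exp_add, ← Real.exp_add, Real.exp_eq_one_iff]
    ring
  refine hlt.not_ge ?_
  calc ℓ * Real.exp a
      = m * Real.exp (-ℓ / r) * (ℓ / r * (3 - ℓ / r)) * Real.exp a := by rw [← hℓ_eq]
    _ ≤ m * Real.exp (-ℓ / r) * ((Real.sqrt 13 - 2) * Real.exp (ℓ / r - a)) * Real.exp a := by
        gcongr
    _ = m * (Real.sqrt 13 - 2) := by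
        linear_combination m * (Real.sqrt 13 - 2) * hexp
end

section
/- Let m > 0, ℓ > 0 and L ∈ ℝ, and let V₋₁(r) = (1 − 2m e^{−ℓ/r}/r)(1 + L²/r²) for r > 0. Then for every r > 0 with r²·e^{ℓ/r} − m(3r − ℓ) ≠ 0, the derivative V₋₁′(r) vanishes if and only if L²·(r²·e^{ℓ/r} − m(3r − ℓ)) = m·r²·(r − ℓ); in particular, a circular timelike orbit at radius r requires angular momentum per unit mass satisfying L_c² = m·r²·(r − ℓ)/(mℓ − 3mr + r²·e^{ℓ/r}). -/
/-- The derivative of the timelike effective potential of the aMc spacetime. -/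
theorem hasDerivAt_aMc_timelike_potential (m ℓ L : ℝ) {r : ℝ} (hr : r ≠ 0) :
    HasDerivAt (fun s : ℝ => (1 - 2 * m * Real.exp (-ℓ / s) / s) * (1 + L ^ 2 / s ^ 2))
      (2 * Real.exp (-ℓ / r) / r ^ 5 *
        (m * r ^ 2 * (r - ℓ) - L ^ 2 * (r ^ 2 * Real.exp (ℓ / r) - m * (3 * r - ℓ)))) r := by
  have hexp : HasDerivAt (fun s : ℝ => Real.exp (-ℓ / s)) _ r :=
    ((hasDerivAt_const r (-ℓ)).fun_div (hasDerivAt_id' r) hr).exp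
  have hmetric : HasDerivAt (fun s : ℝ => 1 - 2 * m * Real.exp (-ℓ / s) / s) _ r :=
    ((hexp.const_mul (2 * m)).fun_div (hasDerivAt_id' r) hr).const_sub 1
  have hangular : HasDerivAt (fun s : ℝ => 1 + L ^ 2 / s ^ 2) _ r :=
    ((hasDerivAt_const r (L ^ 2)).fun_div (hasDerivAt_pow 2 r) (pow_ne_zero 2 hr)).const_add 1
  refine (hmetric.fun_mul hangular).congr_deriv ?_
  have hE : Real.exp (-ℓ / r) = (Real.exp (ℓ / r))⁻¹ := by rw [neg_div, Real.exp_neg]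
  have hE0 : Real.exp (ℓ / r) ≠ 0 := Real.exp_ne_zero _
  rw [hE]
  generalize Real.exp (ℓ / r) = E at hE0 ⊢
  field_simp
  ring

/-- Circular timelike orbits in the aMc spacetime: with effective potential
`V₋₁(r) = (1 − 2m e^{−ℓ/r}/r)(1 + L²/r²)`, for every `r > 0` with
`r²e^{ℓ/r} − m(3r − ℓ) ≠ 0` one has `V₋₁′(r) = 0` iff
`L²·(r²e^{ℓ/r} − m(3r − ℓ)) = m r² (r − ℓ)`; in particular a circular
orbit at `r` requires `L² = m r² (r − ℓ)/(mℓ − 3mr + r²e^{ℓ/r})`. -/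
theorem aMc_timelike_circular_orbits (m ℓ L : ℝ) (hm : 0 < m) (hℓ : 0 < ℓ) :
    ∀ r : ℝ, 0 < r → r ^ 2 * Real.exp (ℓ / r) - m * (3 * r - ℓ) ≠ 0 →
      (deriv (fun s : ℝ => (1 - 2 * m * Real.exp (-ℓ / s) / s) * (1 + L ^ 2 / s ^ 2)) r = 0 ↔
        L ^ 2 * (r ^ 2 * Real.exp (ℓ / r) - m * (3 * r - ℓ)) = m * r ^ 2 * (r - ℓ)) ∧
      (deriv (fun s : ℝ => (1 - 2 * m * Real.exp (-ℓ / s) / s) * (1 + L ^ 2 / s ^ 2)) r = 0 →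
        L ^ 2 = m * r ^ 2 * (r - ℓ) / (m * ℓ - 3 * m * r + r ^ 2 * Real.exp (ℓ / r))) := by
  intro r hr hne
  have hcoef : 2 * Real.exp (-ℓ / r) / r ^ 5 ≠ 0 := by positivity
  rw [(hasDerivAt_aMc_timelike_potential m ℓ L hr.ne').deriv, mul_eq_zero, or_iff_right hcoef,
    sub_eq_zero]
  refine ⟨eq_comm, fun h => ?_⟩
  have hden : m * ℓ - 3 * m * r + r ^ 2 * Real.exp (ℓ / r) =
      r ^ 2 * Real.exp (ℓ / r) - m * (3 * r - ℓ) := by ring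
  rw [hden, eq_div_iff hne, h]
end

section
/- Let m > 0, ℓ > 0 and L ≠ 0, and let V₀(r) = (1 − 2m/√(r² + ℓ²))·L²/(r² + ℓ²) for r > 0. If ℓ < 3m, then for r > 0 one has V₀′(r) = 0 exactly when r = √(9m² − ℓ²); i.e. the photon sphere of Simpson–Visser spacetime is located at r_γ = √((3m)² − ℓ²). If instead ℓ ≥ 3m, then V₀ has no critical point in (0, ∞). -/
/-- The derivative of the null effective potential: with `R = √(r² + ℓ²)`,
it equals `2 L² r (3m − R) / R⁵`. -/
theorem hasDerivAt_nullPotential (m L : ℝ) {ℓ : ℝ} (hℓ : ℓ ≠ 0) (r : ℝ) :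
    HasDerivAt (fun s : ℝ =>
        (1 - 2 * m / Real.sqrt (s ^ 2 + ℓ ^ 2)) * L ^ 2 / (s ^ 2 + ℓ ^ 2))
      (2 * L ^ 2 * r * (3 * m - Real.sqrt (r ^ 2 + ℓ ^ 2)) / Real.sqrt (r ^ 2 + ℓ ^ 2) ^ 5) r := by
  have hpos : 0 < r ^ 2 + ℓ ^ 2 := by positivity
  have hR : 0 < Real.sqrt (r ^ 2 + ℓ ^ 2) := Real.sqrt_pos.2 hpos
  have hsq : Real.sqrt (r ^ 2 + ℓ ^ 2) ^ 2 = r ^ 2 + ℓ ^ 2 := Real.sq_sqrt hpos.le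
  have hu : HasDerivAt (fun s : ℝ => s ^ 2 + ℓ ^ 2) (2 * r) r := by
    simpa using (hasDerivAt_pow 2 r).add_const (ℓ ^ 2)
  have h := ((((hasDerivAt_const r (2 * m)).fun_div (hu.sqrt hpos.ne') hR.ne').const_sub 1).mul_const
    (L ^ 2)).fun_div hu hpos.ne'
  refine h.congr_deriv ?_
  rw [← hsq]
  simp only [Real.sqrt_sq hR.le]
  field_simp
  ring

/-- The critical points of the null effective potential in `r > 0` are the solutions of
`√(r² + ℓ²) = 3m`. -/
theorem deriv_nullPotential_eq_zero_iff (m : ℝ) {ℓ L r : ℝ} (hℓ : ℓ ≠ 0) (hL : L ≠ 0)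
    (hr : 0 < r) :
    deriv (fun s : ℝ =>
        (1 - 2 * m / Real.sqrt (s ^ 2 + ℓ ^ 2)) * L ^ 2 / (s ^ 2 + ℓ ^ 2)) r = 0 ↔
      Real.sqrt (r ^ 2 + ℓ ^ 2) = 3 * m := by
  have hR : Real.sqrt (r ^ 2 + ℓ ^ 2) ≠ 0 := (Real.sqrt_pos.2 (by positivity)).ne'
  rw [(hasDerivAt_nullPotential m L hℓ r).deriv, div_eq_zero_iff, or_iff_left (pow_ne_zero 5 hR),
    mul_eq_zero, or_iff_right (by positivity), sub_eq_zero, eq_comm]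


/-- The photon sphere of Simpson–Visser spacetime: with null effective
potential `V₀(r) = (1 − 2m/√(r² + ℓ²))·L²/(r² + ℓ²)`, if `ℓ < 3m` then the
unique critical point in `r > 0` is `r = √(9m² − ℓ²)`; if `ℓ ≥ 3m` there is
no critical point in `(0, ∞)`. -/
theorem SV_photon_sphere (m ℓ L : ℝ) (hm : 0 < m) (hℓ : 0 < ℓ) (hL : L ≠ 0) :
    (ℓ < 3 * m → ∀ r : ℝ, 0 < r →
      (deriv (fun s : ℝ =>
          (1 - 2 * m / Real.sqrt (s ^ 2 + ℓ ^ 2)) * L ^ 2 / (s ^ 2 + ℓ ^ 2)) r = 0 ↔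
        r = Real.sqrt (9 * m ^ 2 - ℓ ^ 2))) ∧
    (3 * m ≤ ℓ → ∀ r : ℝ, 0 < r →
      deriv (fun s : ℝ =>
          (1 - 2 * m / Real.sqrt (s ^ 2 + ℓ ^ 2)) * L ^ 2 / (s ^ 2 + ℓ ^ 2)) r ≠ 0) := by
  refine ⟨fun h r hr => ?_, fun h r hr => ?_⟩
  · rw [deriv_nullPotential_eq_zero_iff m hℓ.ne' hL hr,
      Real.sqrt_eq_iff_eq_sq (by positivity) (by positivity), eq_comm (a := r),
      Real.sqrt_eq_iff_eq_sq (by nlinarith) hr.le]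
    constructor <;> intro h <;> linarith
  · rw [Ne, deriv_nullPotential_eq_zero_iff m hℓ.ne' hL hr]
    have : ℓ < Real.sqrt (r ^ 2 + ℓ ^ 2) := Real.lt_sqrt_of_sq_lt (by nlinarith)
    linarith
end

section
/- Let m > 0 and 0 < ℓ < 6m. The function r ↦ m·(r² + ℓ²)/(√(r² + ℓ²) − 3m), defined for those r > 0 with r² + ℓ² > 9m², attains a strict global minimum, with value 12m², exactly at r = √(36m² − ℓ²); i.e. the innermost stable circular orbit (ISCO) of Simpson–Visser spacetime is located at r_{ISCO} = √((6m)² − ℓ²). -/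
/-- The ISCO of Simpson–Visser spacetime: for `0 < ℓ < 6m`, the function
`r ↦ m(r² + ℓ²)/(√(r² + ℓ²) − 3m)` on `{r > 0 : r² + ℓ² > 9m²}` attains a
strict global minimum, of value `12m²`, exactly at `r = √(36m² − ℓ²)`. -/
theorem SV_ISCO (m ℓ : ℝ) (hm : 0 < m) (hℓ : 0 < ℓ) (hℓ6 : ℓ < 6 * m) :
    (0 < Real.sqrt (36 * m ^ 2 - ℓ ^ 2) ∧
      9 * m ^ 2 < (Real.sqrt (36 * m ^ 2 - ℓ ^ 2)) ^ 2 + ℓ ^ 2) ∧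
    m * ((Real.sqrt (36 * m ^ 2 - ℓ ^ 2)) ^ 2 + ℓ ^ 2) /
        (Real.sqrt ((Real.sqrt (36 * m ^ 2 - ℓ ^ 2)) ^ 2 + ℓ ^ 2) - 3 * m) = 12 * m ^ 2 ∧
    (∀ r : ℝ, 0 < r → 9 * m ^ 2 < r ^ 2 + ℓ ^ 2 →
      r ≠ Real.sqrt (36 * m ^ 2 - ℓ ^ 2) →
      12 * m ^ 2 < m * (r ^ 2 + ℓ ^ 2) / (Real.sqrt (r ^ 2 + ℓ ^ 2) - 3 * m)) := by
  have hpos : 0 < 36 * m ^ 2 - ℓ ^ 2 := by nlinarith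
  have hsum : Real.sqrt (36 * m ^ 2 - ℓ ^ 2) ^ 2 + ℓ ^ 2 = (6 * m) ^ 2 := by
    rw [Real.sq_sqrt hpos.le]
    ring
  refine ⟨⟨Real.sqrt_pos.2 hpos, ?_⟩, ?_, ?_⟩
  · rw [hsum]
    nlinarith [pow_pos hm 2]
  · rw [hsum, Real.sqrt_sq (by positivity), div_eq_iff (by linarith)]
    ring
  · intro r hr hdom hne
    have hz : Real.sqrt (r ^ 2 + ℓ ^ 2) ^ 2 = r ^ 2 + ℓ ^ 2 := Real.sq_sqrt (by positivity)
    have hlt : 3 * m < Real.sqrt (r ^ 2 + ℓ ^ 2) := Real.lt_sqrt_of_sq_lt (by linarith)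
    have hz_ne : Real.sqrt (r ^ 2 + ℓ ^ 2) - 6 * m ≠ 0 := by
      intro h
      apply hne
      rw [sub_eq_zero.1 h] at hz
      rw [show 36 * m ^ 2 - ℓ ^ 2 = r ^ 2 by linarith, Real.sqrt_sq hr.le]
    rw [lt_div_iff₀ (sub_pos.2 hlt)]
    linear_combination mul_pos hm (sq_pos_iff.2 hz_ne) + m * hz
end

section
/- Let 0 < ℓ < 2m and set r_H = √((2m)² − ℓ²). Then ∫₀^{r_H} ℓ²·r·(√(r² + ℓ²) − 2m)/(r² + ℓ²)² dr = −(2m − ℓ)²/(4m), and ∫_{r_H}^∞ ℓ²·r·(2m − √(r² + ℓ²))/(r² + ℓ²)² dr = −ℓ²/(4m). -/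
open MeasureTheory

open Filter Topology in
/-- `√(r² + ℓ²) → ∞` as `r → ∞`. -/
theorem tendsto_sqrt_sq_add_sq_atTop (ℓ : ℝ) :
    Tendsto (fun r : ℝ => Real.sqrt (r ^ 2 + ℓ ^ 2)) atTop atTop :=
  tendsto_atTop_mono (fun _ => Real.le_sqrt_of_sq_le (le_add_of_nonneg_right (sq_nonneg ℓ))) tendsto_id

/-- An antiderivative of the exotic-matter integrand. -/
theorem hasDerivAt_exoticMatter (m ℓ r : ℝ) (hℓ : ℓ ≠ 0) :
    HasDerivAt
      (fun r : ℝ => ℓ ^ 2 * (m * (Real.sqrt (r ^ 2 + ℓ ^ 2))⁻¹ ^ 2 - (Real.sqrt (r ^ 2 + ℓ ^ 2))⁻¹))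
      (ℓ ^ 2 * r * (Real.sqrt (r ^ 2 + ℓ ^ 2) - 2 * m) / (r ^ 2 + ℓ ^ 2) ^ 2) r := by
  have hpos : 0 < r ^ 2 + ℓ ^ 2 := by positivity
  have hs : 0 < Real.sqrt (r ^ 2 + ℓ ^ 2) := Real.sqrt_pos.mpr hpos
  have hinv := ((((hasDerivAt_id r).pow 2).add_const (ℓ ^ 2)).sqrt hpos.ne').fun_inv hs.ne'
  refine ((((hinv.fun_pow 2).const_mul m).sub hinv).const_mul (ℓ ^ 2)).congr_deriv ?_
  have hsq : r ^ 2 + ℓ ^ 2 = Real.sqrt (r ^ 2 + ℓ ^ 2) ^ 2 := (Real.sq_sqrt hpos.le).symm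
  simp only [id, Pi.pow_apply, Nat.cast_ofNat, Nat.add_one_sub_one, pow_one]
  generalize Real.sqrt (r ^ 2 + ℓ ^ 2) = s at *
  rw [hsq]
  field_simp
  ring

open Filter Topology in
/-- The antiderivative of the exotic-matter integrand vanishes at infinity. -/
theorem tendsto_exoticMatter_atTop (m ℓ : ℝ) :
    Tendsto
      (fun r : ℝ => ℓ ^ 2 * (m * (Real.sqrt (r ^ 2 + ℓ ^ 2))⁻¹ ^ 2 - (Real.sqrt (r ^ 2 + ℓ ^ 2))⁻¹))
      atTop (𝓝 0) := by
  have h := (tendsto_sqrt_sq_add_sq_atTop ℓ).inv_tendsto_atTop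
  simpa using (((h.pow 2).const_mul m).sub h).const_mul (ℓ ^ 2)

/-- Exotic-matter integrals of the Simpson–Visser regular black hole
(`0 < ℓ < 2m`, horizon `r_H = √((2m)² − ℓ²)`): the amount inside the horizon
is `−(2m − ℓ)²/(4m)` and the amount outside is `−ℓ²/(4m)`. -/
theorem SV_exotic_matter_black_hole (m ℓ : ℝ) (hm : 0 < m) (hℓ : 0 < ℓ)
    (hℓ2 : ℓ < 2 * m) :
    (∫ r in (0 : ℝ)..Real.sqrt ((2 * m) ^ 2 - ℓ ^ 2),
        ℓ ^ 2 * r * (Real.sqrt (r ^ 2 + ℓ ^ 2) - 2 * m) / (r ^ 2 + ℓ ^ 2) ^ 2)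
      = -(2 * m - ℓ) ^ 2 / (4 * m) ∧
    IntegrableOn
      (fun r : ℝ => ℓ ^ 2 * r * (2 * m - Real.sqrt (r ^ 2 + ℓ ^ 2)) / (r ^ 2 + ℓ ^ 2) ^ 2)
      (Set.Ioi (Real.sqrt ((2 * m) ^ 2 - ℓ ^ 2))) ∧
    (∫ r in Set.Ioi (Real.sqrt ((2 * m) ^ 2 - ℓ ^ 2)),
        ℓ ^ 2 * r * (2 * m - Real.sqrt (r ^ 2 + ℓ ^ 2)) / (r ^ 2 + ℓ ^ 2) ^ 2)
      = -ℓ ^ 2 / (4 * m) := by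
  have hH : Real.sqrt (Real.sqrt ((2 * m) ^ 2 - ℓ ^ 2) ^ 2 + ℓ ^ 2) = 2 * m := by
    rw [Real.sq_sqrt (by nlinarith), sub_add_cancel, Real.sqrt_sq (by positivity)]
  have hderiv (r : ℝ) := hasDerivAt_exoticMatter m ℓ r hℓ.ne'
  have hneg : (fun r : ℝ =>
        ℓ ^ 2 * r * (2 * m - Real.sqrt (r ^ 2 + ℓ ^ 2)) / (r ^ 2 + ℓ ^ 2) ^ 2) =
      fun r => -(ℓ ^ 2 * r * (Real.sqrt (r ^ 2 + ℓ ^ 2) - 2 * m) / (r ^ 2 + ℓ ^ 2) ^ 2) := by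
    funext r
    ring
  have hnonneg : ∀ r ∈ Set.Ioi (Real.sqrt ((2 * m) ^ 2 - ℓ ^ 2)),
      0 ≤ ℓ ^ 2 * r * (Real.sqrt (r ^ 2 + ℓ ^ 2) - 2 * m) / (r ^ 2 + ℓ ^ 2) ^ 2 := by
    intro r hr
    have hr' : Real.sqrt ((2 * m) ^ 2 - ℓ ^ 2) ≤ r := le_of_lt hr
    have hr0 : 0 ≤ r := (Real.sqrt_nonneg _).trans hr'
    have hs : 0 ≤ Real.sqrt (r ^ 2 + ℓ ^ 2) - 2 * m := by
      rw [sub_nonneg, ← hH]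
      gcongr
    positivity
  refine ⟨?_, ?_, ?_⟩
  · rw [intervalIntegral.integral_eq_sub_of_hasDerivAt (fun r _ => hderiv r), hH,
      zero_pow two_ne_zero, zero_add, Real.sqrt_sq hℓ.le]
    · field_simp
      ring
    · refine Continuous.intervalIntegrable ?_ _ _
      have h0 (r : ℝ) : (r ^ 2 + ℓ ^ 2) ^ 2 ≠ 0 := by positivity
      fun_prop (disch := exact h0 _)
  · rw [hneg]
    exact (integrableOn_Ioi_deriv_of_nonneg' (fun r _ => hderiv r) hnonneg
      (tendsto_exoticMatter_atTop m ℓ)).neg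
  · rw [hneg, integral_neg, integral_Ioi_of_hasDerivAt_of_nonneg' (fun r _ => hderiv r) hnonneg
      (tendsto_exoticMatter_atTop m ℓ), hH]
    field_simp
    ring
end

section
/- Let m ≥ 0, Q ∈ ℝ, ℓ > 0, and r > 0. Then 1 − 2m/√(r² + ℓ²) + Q²/(r² + ℓ²) = 0 if and only if Q² ≤ m² and r² equals either (m + √(m² − Q²))² − ℓ² or (m − √(m² − Q²))² − ℓ². In particular, if Q² > m² then the bbRN metric function is nonzero (indeed positive) for all real r, so the geometry has no horizons and is a traversable wormhole. -/
/-- The metric function as a quotient of a quadratic in the areal radius `√a`. -/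
theorem bbRN_metric_eq_div (m Q : ℝ) {a : ℝ} (ha : 0 < a) :
    1 - 2 * m / Real.sqrt a + Q ^ 2 / a = ((Real.sqrt a - m) ^ 2 + (Q ^ 2 - m ^ 2)) / a := by
  have hs : 0 < Real.sqrt a := Real.sqrt_pos.mpr ha
  have hsa : Real.sqrt a ^ 2 = a := Real.sq_sqrt ha.le
  generalize Real.sqrt a = s at hs hsa
  subst hsa
  field_simp
  ring


/-- Horizons of black-bounce Reissner–Nordström spacetime: for `r > 0`,
`f(r) = 1 − 2m/√(r² + ℓ²) + Q²/(r² + ℓ²) = 0` iff `Q² ≤ m²` and `r²` equals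
`(m ± √(m² − Q²))² − ℓ²`. In particular for `Q² > m²` the metric function is
positive everywhere and the geometry is a horizonless traversable wormhole. -/
theorem bbRN_horizons (m Q ℓ : ℝ) (hm : 0 ≤ m) (hℓ : 0 < ℓ) :
    (∀ r : ℝ, 0 < r →
      (1 - 2 * m / Real.sqrt (r ^ 2 + ℓ ^ 2) + Q ^ 2 / (r ^ 2 + ℓ ^ 2) = 0 ↔
        Q ^ 2 ≤ m ^ 2 ∧
          (r ^ 2 = (m + Real.sqrt (m ^ 2 - Q ^ 2)) ^ 2 - ℓ ^ 2 ∨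
           r ^ 2 = (m - Real.sqrt (m ^ 2 - Q ^ 2)) ^ 2 - ℓ ^ 2))) ∧
    (m ^ 2 < Q ^ 2 →
      ∀ r : ℝ, 0 < 1 - 2 * m / Real.sqrt (r ^ 2 + ℓ ^ 2) + Q ^ 2 / (r ^ 2 + ℓ ^ 2)) := by
  have ha : ∀ r : ℝ, 0 < r ^ 2 + ℓ ^ 2 := fun r => by positivity
  refine ⟨fun r _ => ?_, fun h r => ?_⟩
  · rw [bbRN_metric_eq_div m Q (ha r), div_eq_zero_iff, or_iff_left (ha r).ne',
      eq_sub_iff_add_eq, eq_sub_iff_add_eq]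
    have hs : 0 ≤ Real.sqrt (r ^ 2 + ℓ ^ 2) := Real.sqrt_nonneg _
    rw [← Real.sq_sqrt (ha r).le, Real.sqrt_sq hs]
    generalize Real.sqrt (r ^ 2 + ℓ ^ 2) = s at hs
    constructor
    · intro h
      have hQ : Q ^ 2 ≤ m ^ 2 := by nlinarith [sq_nonneg (s - m)]
      have hd : Real.sqrt (m ^ 2 - Q ^ 2) ^ 2 = m ^ 2 - Q ^ 2 := Real.sq_sqrt (by linarith)
      have hsd : (s - m) ^ 2 = Real.sqrt (m ^ 2 - Q ^ 2) ^ 2 := by linarith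
      refine ⟨hQ, (sq_eq_sq_iff_eq_or_eq_neg.mp hsd).imp (fun e => ?_) fun e => ?_⟩ <;>
        congr 1 <;> linarith
    · rintro ⟨hQ, h⟩
      have hd : Real.sqrt (m ^ 2 - Q ^ 2) ^ 2 = m ^ 2 - Q ^ 2 := Real.sq_sqrt (by linarith)
      have hd0 : 0 ≤ Real.sqrt (m ^ 2 - Q ^ 2) := Real.sqrt_nonneg _
      have hdm : Real.sqrt (m ^ 2 - Q ^ 2) ≤ m :=
        Real.sqrt_le_iff.mpr ⟨hm, by linarith [sq_nonneg Q]⟩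
      rcases h with h | h
      · rw [(sq_eq_sq₀ hs (by linarith)).mp h]
        linarith
      · rw [(sq_eq_sq₀ hs (by linarith)).mp h]
        linarith
  · rw [bbRN_metric_eq_div m Q (ha r)]
    exact div_pos (by nlinarith [sq_nonneg (Real.sqrt (r ^ 2 + ℓ ^ 2) - m)]) (ha r)
end

section
/- Let m > 0, Q ∈ ℝ with 8Q² ≤ 9m², ℓ > 0 and L ≠ 0, and let V₀(r) = (1 − 2m/√(r² + ℓ²) + Q²/(r² + ℓ²))·L²/(r² + ℓ²) for r > 0. Then for r > 0 one has V₀′(r) = 0 if and only if (r² + ℓ²) − 3m·√(r² + ℓ²) + 2Q² = 0. In particular, if additionally ℓ² < (m/2)(9m + 3√(9m² − 8Q²)) − 2Q², then r_γ = √((m/2)(9m + 3√(9m² − 8Q²)) − 2Q² − ℓ²) is a critical point of V₀, giving the photon-sphere location of bbRN spacetime. -/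
/-- The derivative of the bbRN null effective potential, as a multiple of the photon-sphere
polynomial in `√(r² + ℓ²)`. -/
theorem hasDerivAt_bbRN_potential (m Q L r : ℝ) {ℓ : ℝ} (hℓ : 0 < ℓ) :
    HasDerivAt (fun s : ℝ =>
        (1 - 2 * m / Real.sqrt (s ^ 2 + ℓ ^ 2) + Q ^ 2 / (s ^ 2 + ℓ ^ 2)) *
          L ^ 2 / (s ^ 2 + ℓ ^ 2))
      (-(2 * L ^ 2 * r / (r ^ 2 + ℓ ^ 2) ^ 3) *
        ((r ^ 2 + ℓ ^ 2) - 3 * m * Real.sqrt (r ^ 2 + ℓ ^ 2) + 2 * Q ^ 2)) r := by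
  have hu : 0 < r ^ 2 + ℓ ^ 2 := by positivity
  have hx : 0 < Real.sqrt (r ^ 2 + ℓ ^ 2) := Real.sqrt_pos.2 hu
  have hsq := Real.sq_sqrt hu.le
  have hd : HasDerivAt (fun s : ℝ => s ^ 2 + ℓ ^ 2) (2 * r) r := by
    simpa using (hasDerivAt_pow 2 r).add_const (ℓ ^ 2)
  have hV := ((((hasDerivAt_const r (1 : ℝ)).sub
    ((hasDerivAt_const r (2 * m)).div (hd.sqrt hu.ne') hx.ne')).add
    ((hasDerivAt_const r (Q ^ 2)).div hd hu.ne')).mul_const (L ^ 2)).div hd hu.ne'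
  refine hV.congr_deriv ?_
  simp only [Pi.add_apply, Pi.sub_apply, Pi.div_apply]
  generalize Real.sqrt (r ^ 2 + ℓ ^ 2) = x at hx hsq ⊢
  rw [← hsq]
  field_simp
  ring

/-- Photon sphere of black-bounce Reissner–Nordström spacetime: with null
effective potential `V₀(r) = (1 − 2m/√(r² + ℓ²) + Q²/(r² + ℓ²))·L²/(r² + ℓ²)`,
for `r > 0` one has `V₀′(r) = 0` iff `(r² + ℓ²) − 3m√(r² + ℓ²) + 2Q² = 0`;
and if `ℓ² < (m/2)(9m + 3√(9m² − 8Q²)) − 2Q²` then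
`r_γ = √((m/2)(9m + 3√(9m² − 8Q²)) − 2Q² − ℓ²)` is a critical point of `V₀`. -/
theorem bbRN_photon_sphere (m Q ℓ L : ℝ) (hm : 0 < m) (hQ : 8 * Q ^ 2 ≤ 9 * m ^ 2)
    (hℓ : 0 < ℓ) (hL : L ≠ 0) :
    (∀ r : ℝ, 0 < r →
      (deriv (fun s : ℝ =>
          (1 - 2 * m / Real.sqrt (s ^ 2 + ℓ ^ 2) + Q ^ 2 / (s ^ 2 + ℓ ^ 2)) *
            L ^ 2 / (s ^ 2 + ℓ ^ 2)) r = 0 ↔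
        (r ^ 2 + ℓ ^ 2) - 3 * m * Real.sqrt (r ^ 2 + ℓ ^ 2) + 2 * Q ^ 2 = 0)) ∧
    (ℓ ^ 2 < m / 2 * (9 * m + 3 * Real.sqrt (9 * m ^ 2 - 8 * Q ^ 2)) - 2 * Q ^ 2 →
      deriv (fun s : ℝ =>
          (1 - 2 * m / Real.sqrt (s ^ 2 + ℓ ^ 2) + Q ^ 2 / (s ^ 2 + ℓ ^ 2)) *
            L ^ 2 / (s ^ 2 + ℓ ^ 2))
        (Real.sqrt (m / 2 * (9 * m + 3 * Real.sqrt (9 * m ^ 2 - 8 * Q ^ 2))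
          - 2 * Q ^ 2 - ℓ ^ 2)) = 0) := by
  refine ⟨fun r hr => ?_, fun h => ?_⟩
  · have hc : -(2 * L ^ 2 * r / (r ^ 2 + ℓ ^ 2) ^ 3) ≠ 0 :=
      neg_ne_zero.2 (by positivity)
    rw [(hasDerivAt_bbRN_potential m Q L r hℓ).deriv, mul_eq_zero, or_iff_right hc]
  · rw [(hasDerivAt_bbRN_potential m Q L _ hℓ).deriv, Real.sq_sqrt (by linarith)]
    have hD := Real.sq_sqrt (sub_nonneg.2 hQ)
    have hD0 := Real.sqrt_nonneg (9 * m ^ 2 - 8 * Q ^ 2)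
    generalize Real.sqrt (9 * m ^ 2 - 8 * Q ^ 2) = D at hD hD0 ⊢
    have hx : m / 2 * (9 * m + 3 * D) - 2 * Q ^ 2 - ℓ ^ 2 + ℓ ^ 2 = ((3 * m + D) / 2) ^ 2 := by
      linear_combination -hD / 4
    rw [hx, Real.sqrt_sq (by positivity)]
    refine mul_eq_zero_of_right _ ?_
    linear_combination hD / 4
end

section
/- Let m > 0, ℓ > 0 and a ∈ ℝ. If r > 0 satisfies r² + a² = 2·m·r·e^{−ℓ/r} (i.e. Δ(r) = 0), then r² − 2mr + a² < 0; consequently a² < m² and m − √(m² − a²) < r < m + √(m² − a²), so every eos horizon lies strictly between the corresponding Kerr horizons. In particular, if |a| ≥ m then Δ(r) > 0 for all r > 0 and the eos spacetime has no horizons. -/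
/-- Eye-of-the-storm horizons are bracketed by Kerr horizons: if `r > 0`
satisfies `r² + a² = 2mr·e^{−ℓ/r}` then `r² − 2mr + a² < 0`, hence `a² < m²`
and `m − √(m² − a²) < r < m + √(m² − a²)`; and if `|a| ≥ m` then `Δ(r) > 0`
for all `r > 0` (no horizons). -/
theorem eos_horizon_bounds (m ℓ a : ℝ) (hm : 0 < m) (hℓ : 0 < ℓ) :
    (∀ r : ℝ, 0 < r → r ^ 2 + a ^ 2 = 2 * m * r * Real.exp (-ℓ / r) →
      r ^ 2 - 2 * m * r + a ^ 2 < 0 ∧ a ^ 2 < m ^ 2 ∧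
      m - Real.sqrt (m ^ 2 - a ^ 2) < r ∧ r < m + Real.sqrt (m ^ 2 - a ^ 2)) ∧
    (m ≤ |a| → ∀ r : ℝ, 0 < r →
      0 < r ^ 2 + a ^ 2 - 2 * m * r * Real.exp (-ℓ / r)) := by
  have hexp : ∀ r : ℝ, 0 < r → 2 * m * r * Real.exp (-ℓ / r) < 2 * m * r := fun r hr =>
    mul_lt_of_lt_one_right (by positivity)
      (Real.exp_lt_one_iff.mpr (div_neg_of_neg_of_pos (neg_lt_zero.mpr hℓ) hr))
  refine ⟨fun r hr h => ?_, fun ha r hr => ?_⟩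
  · have hneg : r ^ 2 - 2 * m * r + a ^ 2 < 0 := by linarith [hexp r hr]
    have hsq : (r - m) ^ 2 < m ^ 2 - a ^ 2 := by linarith
    have habs := abs_lt.mp (Real.lt_sqrt_of_sq_lt (by rwa [sq_abs]))
    exact ⟨hneg, by linarith [sq_nonneg (r - m)], by linarith, by linarith⟩
  · have hsq : m ^ 2 ≤ a ^ 2 := sq_le_sq.mpr (by rwa [abs_of_pos hm])
    linarith [hexp r hr, sq_nonneg (r - m)]
end

section
/- Let m > 0, ℓ > 0 and a ∈ ℝ, and suppose r₊ > r₋ > 0 both satisfy r² + a² = 2·m·r·e^{−ℓ/r} (i.e. they are two distinct horizon radii). Then r₊·e^{−ℓ/r₊} > r₋·e^{−ℓ/r₋}, and the parameters are determined by m = (r₊² − r₋²)/(2(r₊·e^{−ℓ/r₊} − r₋·e^{−ℓ/r₋})) and a² = r₊·r₋·(r₊·e^{−ℓ/r₋} − r₋·e^{−ℓ/r₊})/(r₊·e^{−ℓ/r₊} − r₋·e^{−ℓ/r₋}). -/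
/-- Reverse-engineering the eye-of-the-storm parameters from two distinct
horizon radii `r₊ > r₋ > 0` of `Δ(r) = r² + a² − 2mr·e^{−ℓ/r}`:
one has `r₊e^{−ℓ/r₊} > r₋e^{−ℓ/r₋}`, and `m` and `a²` are determined by the
stated formulas. -/
theorem eos_reverse_engineer (m ℓ a rp rm : ℝ) (hm : 0 < m) (hℓ : 0 < ℓ)
    (h0 : 0 < rm) (hlt : rm < rp)
    (hp : rp ^ 2 + a ^ 2 = 2 * m * rp * Real.exp (-ℓ / rp))
    (hmn : rm ^ 2 + a ^ 2 = 2 * m * rm * Real.exp (-ℓ / rm)) :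
    rm * Real.exp (-ℓ / rm) < rp * Real.exp (-ℓ / rp) ∧
    m = (rp ^ 2 - rm ^ 2) /
        (2 * (rp * Real.exp (-ℓ / rp) - rm * Real.exp (-ℓ / rm))) ∧
    a ^ 2 = rp * rm * (rp * Real.exp (-ℓ / rm) - rm * Real.exp (-ℓ / rp)) /
        (rp * Real.exp (-ℓ / rp) - rm * Real.exp (-ℓ / rm)) := by
  generalize Real.exp (-ℓ / rp) = A at *
  generalize Real.exp (-ℓ / rm) = B at *
  have hD : rm * B < rp * A := by
    have h : 0 < 2 * m * (rp * A - rm * B) := by nlinarith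
    linarith [pos_of_mul_pos_right h (by positivity)]
  have hne : rp * A - rm * B ≠ 0 := (sub_pos.2 hD).ne'
  refine ⟨hD, ?_, ?_⟩
  · rw [eq_div_iff (mul_ne_zero two_ne_zero hne)]
    linear_combination hmn - hp
  · rw [eq_div_iff hne]
    refine mul_left_cancel₀ (mul_ne_zero two_ne_zero hm.ne') ?_
    linear_combination (a ^ 2 + rp ^ 2) * hmn - (a ^ 2 + rm ^ 2) * hp
end

section
/- Let m > 0, ℓ > 0, a ∈ ℝ, and Δ(r) = r² + a² − 2·m·r·e^{−ℓ/r} for r > 0. If r_H > 0 satisfies Δ(r_H) = 0 and Δ′(r_H) = 0 (a degenerate, extremal horizon), then m = r_H²·e^{ℓ/r_H}/(r_H + ℓ) and a² = r_H²·(r_H − ℓ)/(r_H + ℓ); moreover m > r_H and a² < r_H². -/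
/-- The derivative of the horizon function `r² + a² − 2mr·e^{−ℓ/r}` away from `r = 0`. -/
theorem hasDerivAt_eos_horizon (m ℓ a : ℝ) {r : ℝ} (hr : r ≠ 0) :
    HasDerivAt (fun r : ℝ => r ^ 2 + a ^ 2 - 2 * m * r * Real.exp (-ℓ / r))
      (2 * r - 2 * m * Real.exp (-ℓ / r) * (1 + ℓ / r)) r := by
  have hexp := ((hasDerivAt_const r (-ℓ)).div (hasDerivAt_id r) hr).exp
  have h := (((hasDerivAt_id r).pow 2).add_const (a ^ 2)).sub
    (((hasDerivAt_id r).const_mul (2 * m)).mul hexp)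
  refine h.congr_deriv ?_
  simp only [id, Pi.div_apply]
  field_simp
  ring

/-- Extremal horizon of the eye-of-the-storm spacetime: if `r_H > 0` is a
common root of `Δ(r) = r² + a² − 2mr·e^{−ℓ/r}` and its derivative, then
`m = r_H²·e^{ℓ/r_H}/(r_H + ℓ)` and `a² = r_H²·(r_H − ℓ)/(r_H + ℓ)`; moreover
`m > r_H` and `a² < r_H²`. -/
theorem eos_extremal_horizon (m ℓ a rH : ℝ) (hm : 0 < m) (hℓ : 0 < ℓ)
    (hrH : 0 < rH)
    (h0 : rH ^ 2 + a ^ 2 - 2 * m * rH * Real.exp (-ℓ / rH) = 0)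
    (h1 : deriv (fun r : ℝ => r ^ 2 + a ^ 2 - 2 * m * r * Real.exp (-ℓ / r)) rH = 0) :
    m = rH ^ 2 * Real.exp (ℓ / rH) / (rH + ℓ) ∧
    a ^ 2 = rH ^ 2 * (rH - ℓ) / (rH + ℓ) ∧
    rH < m ∧ a ^ 2 < rH ^ 2 := by
  rw [(hasDerivAt_eos_horizon m ℓ a hrH.ne').deriv] at h1
  have hsum : 0 < rH + ℓ := add_pos hrH hℓ
  have hmul : Real.exp (-ℓ / rH) * Real.exp (ℓ / rH) = 1 := by
    rw [← Real.exp_add, ← add_div, neg_add_cancel, zero_div, Real.exp_zero]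
  have hcrit : m * Real.exp (-ℓ / rH) * (rH + ℓ) = rH ^ 2 := by
    field_simp at h1
    rw [← neg_div] at h1
    linarith
  have hm_eq : m = rH ^ 2 * Real.exp (ℓ / rH) / (rH + ℓ) := by
    rw [eq_div_iff hsum.ne', ← hcrit]
    linear_combination -(m * (rH + ℓ)) * hmul
  have ha_eq : a ^ 2 = rH ^ 2 * (rH - ℓ) / (rH + ℓ) := by
    rw [eq_div_iff hsum.ne']
    linear_combination (rH + ℓ) * h0 + 2 * rH * hcrit
  refine ⟨hm_eq, ha_eq, ?_, ?_⟩
  · rw [hm_eq, lt_div_iff₀ hsum]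
    have hlt : rH + ℓ < rH * Real.exp (ℓ / rH) := by
      calc rH + ℓ = rH * (ℓ / rH + 1) := by field_simp; ring
        _ < rH * Real.exp (ℓ / rH) :=
          mul_lt_mul_of_pos_left (Real.add_one_lt_exp (div_pos hℓ hrH).ne') hrH
    calc rH * (rH + ℓ) < rH * (rH * Real.exp (ℓ / rH)) := mul_lt_mul_of_pos_left hlt hrH
      _ = rH ^ 2 * Real.exp (ℓ / rH) := by ring
  · rw [ha_eq, div_lt_iff₀ hsum]
    exact mul_lt_mul_of_pos_left (by linarith) (pow_pos hrH 2)
end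

section
/- For all real χ and X with 0 ≤ χ < X < 1, one has ((1 − X/2)/√(1 − X) − (1 − χ/2)/√(1 − χ)) / (2(√(1 − χ) − √(1 − X))) = (1/4)·(1/(√(1 − χ)·√(1 − X)) − 1). Equivalently, the ratio of surface stress to surface energy density of a thin-shell Dyson mega-sphere is w = Π/σ = (1/4)·(1/(√(1 − χ)·√(1 − X)) − 1). -/
/-- Stress-to-density ratio of a thin-shell Dyson mega-sphere: for
compactness parameters `0 ≤ χ < X < 1`,
`w = Π/σ = ((1 − X/2)/√(1 − X) − (1 − χ/2)/√(1 − χ)) / (2(√(1 − χ) − √(1 − X)))`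
equals `(1/4)(1/(√(1 − χ)√(1 − X)) − 1)`. -/
theorem dyson_stress_ratio (χ X : ℝ) (h0 : 0 ≤ χ) (h1 : χ < X) (h2 : X < 1) :
    ((1 - X / 2) / Real.sqrt (1 - X) - (1 - χ / 2) / Real.sqrt (1 - χ)) /
      (2 * (Real.sqrt (1 - χ) - Real.sqrt (1 - X)))
    = 1 / 4 * (1 / (Real.sqrt (1 - χ) * Real.sqrt (1 - X)) - 1) := by
  have hq : 0 < Real.sqrt (1 - X) := Real.sqrt_pos.2 (by linarith)
  have hqp : Real.sqrt (1 - X) < Real.sqrt (1 - χ) :=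
    Real.sqrt_lt_sqrt (by linarith) (by linarith)
  have hX : 1 - X / 2 = (1 + Real.sqrt (1 - X) ^ 2) / 2 := by
    rw [Real.sq_sqrt (by linarith)]; ring
  have hχ : 1 - χ / 2 = (1 + Real.sqrt (1 - χ) ^ 2) / 2 := by
    rw [Real.sq_sqrt (by linarith)]; ring
  rw [hX, hχ]
  generalize Real.sqrt (1 - X) = q at *
  generalize Real.sqrt (1 - χ) = p at *
  have hp : p ≠ 0 := (hq.trans hqp).ne'
  have hpq : p - q ≠ 0 := sub_ne_zero.2 hqp.ne'
  have hq' : q ≠ 0 := hq.ne'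
  field_simp
  ring
end

section
/- For every real X ∈ (0, 1), one has (1/4)·((1 − X/2)/√(1 − X) − 1) > 1/4 if and only if X > 4√3 − 6. Hence an empty (m = 0) thin-shell Dyson mega-sphere violates the maximum force bound F ≤ 1/4 exactly when its compactness X = 2M/a lies in the interval (4√3 − 6, 1). -/
/-- Maximum-force violation for an empty (`m = 0`) thin-shell Dyson
mega-sphere: for compactness `X ∈ (0, 1)`, the hemisphere force
`F = (1/4)((1 − X/2)/√(1 − X) − 1)` exceeds `1/4` iff `X > 4√3 − 6`. -/
theorem dyson_max_force_empty (X : ℝ) (h0 : 0 < X) (h1 : X < 1) :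
    1 / 4 < 1 / 4 * ((1 - X / 2) / Real.sqrt (1 - X) - 1) ↔
      4 * Real.sqrt 3 - 6 < X := by
  have force_iff : 1 / 4 < 1 / 4 * ((1 - X / 2) / Real.sqrt (1 - X) - 1) ↔
      Real.sqrt (1 - X) < (1 - X / 2) / 2 := by
    have key := lt_div_iff₀ (a := 2) (b := 1 - X / 2) (Real.sqrt_pos.2 (sub_pos.2 h1))
    constructor
    · intro h
      linarith [key.1 (by linarith)]
    · intro h
      linarith [key.2 (by linarith)]
  have threshold_iff : 4 * Real.sqrt 3 - 6 < X ↔ Real.sqrt 3 < (X + 6) / 4 := by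
    constructor <;> intro h <;> linarith
  rw [force_iff, threshold_iff, Real.sqrt_lt' (by linarith), Real.sqrt_lt' (by linarith)]
  constructor <;> intro h <;> linarith
end
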